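/- Let m ≥ 3 be an integer and let G be a finite simple digonless m-free digraph. Then there exists a vertex v of G such that d^{++}(v) ≥ λ_m · d^+(v), where λ_m is the unique root in (0,1) of g_m(x) = 2x^3 - (m-3)x^2 + (2m-4)x - (m-1). -/

import Mathlib

/-- Out-degree of `v`: the number of out-neighbors. -/
noncomputable def outDeg {V : Type*} (Adj : V → V → Prop) (v : V) : ℕ :=
  {w | Adj v w}.ncard

/-- The set of vertices at directed distance exactly 2 from `v`. -/
def secondNbr {V : Type*} (Adj : V → V → Prop) (v : V) : Set V :=
  {w | w ≠ v ∧ ¬ Adj v w ∧ ∃ u, Adj v u ∧ Adj u w}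

/-- `Adj` has a directed cycle of length `k`. -/
def HasCycleOfLength {V : Type*} (Adj : V → V → Prop) (k : ℕ) : Prop :=
  ∃ c : Fin k → V, Function.Injective c ∧ ∀ i : Fin k, Adj (c i) (c ⟨(i.val + 1) % k, Nat.mod_lt _ i.pos⟩)

/-- `Adj` has no directed cycles. -/
def Acyclic {V : Type*} (Adj : V → V → Prop) : Prop :=
  ∀ k : ℕ, 1 ≤ k → ¬ HasCycleOfLength Adj k

/-- `Adj` is `m`-free: it has no directed cycle of length at most `m`. -/
def MFree {V : Type*} (Adj : V → V → Prop) (m : ℕ) : Prop :=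
  ∀ k : ℕ, 1 ≤ k → k ≤ m → ¬ HasCycleOfLength Adj k

/-- `T` is a tournament: irreflexive and exactly one arc between distinct vertices. -/
def IsTournament {V : Type*} (T : V → V → Prop) : Prop :=
  (∀ v, ¬ T v v) ∧ ∀ a b : V, a ≠ b → (T a b ↔ ¬ T b a)

/-- The number of arcs of `T` that are missing in `Adj`. -/
noncomputable def deletedCount {V : Type*} (T Adj : V → V → Prop) : ℕ :=
  {p : V × V | T p.1 p.2 ∧ ¬ Adj p.1 p.2}.ncard

def gpoly (m : ℕ) (x : ℝ) : ℝ :=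
  2 * x ^ 3 - ((m : ℝ) - 3) * x ^ 2 + (2 * (m : ℝ) - 4) * x - ((m : ℝ) - 1)

section SecondNeighborhood

open Finset
open scoped Classical

/-- There is a directed walk with `n` arcs from `x` to `y`. -/
def IsWalk {V : Type*} (R : V → V → Prop) : ℕ → V → V → Prop
  | 0, x, y => x = y
  | n + 1, x, y => ∃ u, IsWalk R n x u ∧ R u y

/-- The directed distance from `x` to `y` is exactly `n`. -/
def AtDist {V : Type*} (R : V → V → Prop) (n : ℕ) (x y : V) : Prop :=
  IsWalk R n x y ∧ ∀ i < n, ¬ IsWalk R i x y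

/-- Two distinct vertices joined by no arc. -/
def NonAdj {V : Type*} (R : V → V → Prop) (x y : V) : Prop :=
  x ≠ y ∧ ¬ R x y ∧ ¬ R y x

/-- The number of arcs from `A` to `B`. -/
noncomputable def arcs {V : Type*} (R : V → V → Prop) (A B : Finset V) : ℕ :=
  ∑ x ∈ A, #{y ∈ B | R x y}

/-- The number of triples `(b, p, q)` with `p → q` an arc, `b` at distance `j` from `p`
and at distance `j + 1` from `q`. -/
noncomputable def geodesicCount {V : Type*} [Fintype V] (R : V → V → Prop) (j : ℕ) : ℕ :=
  #{t : V × V × V | AtDist R j t.1 t.2.1 ∧ R t.2.1 t.2.2 ∧ AtDist R (j + 1) t.1 t.2.2}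

/-- The vertices reached from `v` by a walk with at least one and at most `i` arcs. -/
noncomputable def outBall {V : Type*} [Fintype V] (R : V → V → Prop) (i : ℕ) (v : V) : Finset V :=
  {x | ∃ k, 1 ≤ k ∧ k ≤ i ∧ IsWalk R k v x}

section Walks

variable {V : Type*} {R : V → V → Prop}

lemma isWalk_one {x y : V} : IsWalk R 1 x y ↔ R x y := by
  simp [IsWalk]

lemma IsWalk.append {a b : ℕ} {x y z : V} (h : IsWalk R a x y) (h' : IsWalk R b y z) :
    IsWalk R (a + b) x z := by
  induction b generalizing z with
  | zero => obtain rfl : y = z := h'; exact h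
  | succ b ih => obtain ⟨u, hu, huz⟩ := h'; exact ⟨u, ih hu, huz⟩

lemma IsWalk.swap {n : ℕ} {x y : V} (h : IsWalk R n x y) : IsWalk (flip R) n y x := by
  induction n generalizing y with
  | zero => exact Eq.symm h
  | succ n ih =>
    obtain ⟨u, hu, huy⟩ := h
    rw [Nat.add_comm]
    exact (isWalk_one.2 (show flip R y u from huy)).append (ih hu)

lemma isWalk_flip {n : ℕ} {x y : V} : IsWalk (flip R) n x y ↔ IsWalk R n y x :=
  ⟨fun h => h.swap, fun h => h.swap⟩

lemma atDist_flip {n : ℕ} {x y : V} : AtDist (flip R) n x y ↔ AtDist R n y x := by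
  simp [AtDist, isWalk_flip]

lemma AtDist.unique {a b : ℕ} {x y : V} (h : AtDist R a x y) (h' : AtDist R b x y) : a = b := by
  rcases lt_trichotomy a b with hab | hab | hab
  · exact absurd h.1 (h'.2 _ hab)
  · exact hab
  · exact absurd h'.1 (h.2 _ hab)

lemma IsWalk.exists_seq {n : ℕ} {x y : V} (h : IsWalk R n x y) :
    ∃ f : ℕ → V, f 0 = x ∧ f n = y ∧ ∀ i < n, R (f i) (f (i + 1)) := by
  induction n generalizing y with
  | zero => exact ⟨fun _ => x, rfl, h, by simp⟩
  | succ n ih =>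
    obtain ⟨u, hu, huy⟩ := h
    obtain ⟨f, h0, hn, hf⟩ := ih hu
    refine ⟨fun i => if i ≤ n then f i else y, by simpa using h0, by simp, fun i hi => ?_⟩
    rcases Nat.lt_or_ge i n with hin | hin
    · simpa [hin.le, Nat.succ_le_of_lt hin] using hf i hin
    · obtain rfl : i = n := by omega
      simpa [hn] using huy

lemma isWalk_of_seq {f : ℕ → V} {a : ℕ} : ∀ {n : ℕ},
    (∀ i < n, R (f (a + i)) (f (a + i + 1))) → IsWalk R n (f a) (f (a + n))
  | 0, _ => rfl
  | n + 1, h => ⟨f (a + n), isWalk_of_seq fun i hi => h i (by omega), h n (by omega)⟩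

lemma MFree.mono {m : ℕ} {R' : V → V → Prop} (h : MFree R m) (hR : ∀ x y, R' x y → R x y) : MFree R' m :=
  fun k hk hkm ⟨c, hc, hadj⟩ => h k hk hkm ⟨c, hc, fun i => hR _ _ (hadj i)⟩

lemma MFree.not_isWalk {m : ℕ} (h : MFree R m) :
    ∀ k x, 1 ≤ k → k ≤ m → ¬ IsWalk R k x x := by
  intro k
  induction k using Nat.strong_induction_on with
  | _ k ih =>
    intro x hk hkm hw
    obtain ⟨f, h0, hn, hf⟩ := hw.exists_seq
    have hinj : ∀ i j, i < j → j < k → f i ≠ f j := by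
      intro i j hij hjk hfe
      refine ih (j - i) (by omega) (f i) (by omega) (by omega) ?_
      have := isWalk_of_seq (R := R) (f := f) (a := i) (n := j - i)
        fun l hl => hf (i + l) (by omega)
      rwa [Nat.add_sub_cancel' hij.le, ← hfe] at this
    refine h k hk hkm ⟨fun i => f i, fun i j hij => ?_, fun i => ?_⟩
    · by_contra hne
      rcases lt_or_gt_of_ne hne with hlt | hlt
      · exact hinj _ _ hlt j.2 hij
      · exact hinj _ _ hlt i.2 hij.symm
    · have hi := hf i i.2
      rcases Nat.lt_or_ge (i.1 + 1) k with hlt | hge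
      · simpa [Nat.mod_eq_of_lt hlt] using hi
      · have hik : i.1 + 1 = k := by have := i.2; omega
        simp only [hik, Nat.mod_self, h0]
        rwa [hik, hn] at hi

lemma nonAdj_of_atDist {m : ℕ} (hR : ∀ k x, 1 ≤ k → k ≤ m → ¬ IsWalk R k x x) {j : ℕ} {b q : V}
    (hj : 2 ≤ j) (hjm : j + 1 ≤ m) (h : AtDist R j b q) : NonAdj R q b :=
  ⟨fun hqb => h.2 0 (by omega) hqb.symm,
    fun hqb => hR (j + 1) b (by omega) hjm (h.1.append (isWalk_one.2 hqb)),
    fun hbq => h.2 1 (by omega) (isWalk_one.2 hbq)⟩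

lemma nonAdj_flip : NonAdj (flip R) = flip (NonAdj R) := by
  funext x y
  simp only [NonAdj, flip, ne_comm]

end Walks

section Counting

variable {V : Type*} {R R' : V → V → Prop} {A B C : Finset V}

lemma arcs_congr (h : ∀ x ∈ A, ∀ y ∈ B, (R x y ↔ R' x y)) : arcs R A B = arcs R' A B :=
  sum_congr rfl fun x hx => by rw [filter_congr (h x hx)]

lemma arcs_mono (h : ∀ x ∈ A, ∀ y ∈ B, R x y → R' x y) : arcs R A B ≤ arcs R' A B :=
  sum_le_sum fun x hx => card_le_card fun y hy => by
    rw [mem_filter] at hy ⊢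
    exact ⟨hy.1, h x hx y hy.1 hy.2⟩

lemma arcs_flip : arcs (flip R) B A = arcs R A B :=
  (sum_card_bipartiteAbove_eq_sum_card_bipartiteBelow R).symm

lemma arcs_union_left (h : Disjoint A B) : arcs R (A ∪ B) C = arcs R A C + arcs R B C :=
  sum_union h

lemma arcs_union_right (h : Disjoint B C) : arcs R A (B ∪ C) = arcs R A B + arcs R A C := by
  unfold arcs
  rw [← sum_add_distrib]
  refine sum_congr rfl fun x _ => ?_
  rw [filter_union, card_union_of_disjoint (disjoint_filter_filter h)]

lemma arcs_split (h : A ⊆ B) :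
    arcs R B B = arcs R A A + arcs R A (B \ A) + (arcs R (B \ A) A + arcs R (B \ A) (B \ A)) := by
  have hd : Disjoint A (B \ A) := disjoint_sdiff
  conv_lhs => rw [← union_sdiff_of_subset h]
  rw [arcs_union_left hd, arcs_union_right hd, arcs_union_right hd]

lemma arcs_add_le (h : ∀ x ∈ A, ∀ y ∈ B, R x y → ¬ R' x y) :
    arcs R A B + arcs R' A B ≤ #A * #B := by
  unfold arcs
  rw [← sum_add_distrib, ← smul_eq_mul]
  refine sum_le_card_nsmul _ _ _ fun x hx => ?_
  rw [← card_union_of_disjoint]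
  · exact card_le_card (union_subset (filter_subset _ _) (filter_subset _ _))
  · rw [disjoint_filter]
    exact h x hx

lemma card_mul_le_arcs {c : ℝ} (h : ∀ x ∈ A, c ≤ #{y ∈ B | R x y}) :
    #A * c ≤ arcs R A B := by
  unfold arcs
  push_cast
  rw [← nsmul_eq_mul]
  exact card_nsmul_le_sum _ _ _ h

lemma two_mul_arcs_add_le (hR : ∀ x y, ¬ (R x y ∧ R y x)) :
    2 * arcs R A A + arcs (NonAdj R) A A ≤ #A * #A := by
  have h : arcs R A A + arcs (fun x y => flip R x y ∨ NonAdj R x y) A A ≤ #A * #A :=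
    arcs_add_le fun x _ y _ hxy h => h.elim (fun hyx => hR x y ⟨hxy, hyx⟩) fun hn => hn.2.1 hxy
  have h' : arcs (fun x y => flip R x y ∨ NonAdj R x y) A A =
      arcs (flip R) A A + arcs (NonAdj R) A A := by
    unfold arcs
    rw [← sum_add_distrib]
    refine sum_congr rfl fun x _ => ?_
    rw [← card_union_of_disjoint]
    · congr 1
      ext y
      simp only [mem_filter, mem_union]
      tauto
    · exact disjoint_filter.2 fun y _ hyx hn => hn.2.2 hyx
  rw [arcs_flip] at h'
  omega

lemma sum_arcs [Fintype V] (S : Finset V) (A B : V → Finset V) :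
    ∑ v ∈ S, arcs R (A v) (B v) =
      #{t : V × V × V | t.1 ∈ S ∧ t.2.1 ∈ A t.1 ∧ t.2.2 ∈ B t.1 ∧ R t.2.1 t.2.2} := by
  unfold arcs
  simp_rw [← card_sigma]
  refine card_bij (fun t _ => (t.1, t.2.1, t.2.2)) ?_ ?_ ?_
  · rintro ⟨v, x, y⟩ h
    simpa using h
  · rintro ⟨v, x, y⟩ _ ⟨v', x', y'⟩ _ h
    simp only [Prod.mk.injEq] at h
    obtain ⟨rfl, rfl, rfl⟩ := h
    rfl
  · rintro ⟨v, x, y⟩ h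
    exact ⟨⟨v, x, y⟩, by simpa using h, rfl⟩

end Counting

section Cuts

variable {V : Type*} [Fintype V] {R : V → V → Prop} {m : ℕ} {S : Finset V}

lemma sum_arcs_outBall_le (hR : ∀ k x, 1 ≤ k → k ≤ m → ¬ IsWalk R k x x) {i : ℕ}
    (hi : 1 ≤ i) (him : i + 2 ≤ m) :
    ∑ v ∈ S, arcs R (outBall R i v) (S \ outBall R i v) ≤ geodesicCount R i := by
  rw [sum_arcs]
  refine card_le_card ?_
  rintro ⟨v, x, y⟩ h
  simp only [outBall, mem_filter, mem_univ, true_and, mem_sdiff, not_exists, not_and] at h ⊢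
  obtain ⟨-, ⟨k, hk, hki, hw⟩, ⟨-, hy⟩, hxy⟩ := h
  have far : ∀ l, 1 ≤ l → l < i → ¬ IsWalk R l v x := fun l _ hli hl =>
    hy (l + 1) (by omega) (by omega) ⟨x, hl, hxy⟩
  obtain rfl : k = i := by
    by_contra hne
    exact far k hk (by omega) hw
  refine ⟨⟨hw, fun l hl hlw => ?_⟩, hxy, ⟨x, hw, hxy⟩, fun l hl hlw => ?_⟩
  · rcases Nat.eq_zero_or_pos l with rfl | hpos
    · obtain rfl : v = x := hlw
      exact hR k v hk (by omega) hw
    · exact far l hpos hl hlw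
  · rcases Nat.eq_zero_or_pos l with rfl | hpos
    · obtain rfl : v = y := hlw
      exact hR (k + 1) v (by omega) (by omega) ⟨x, hw, hxy⟩
    · exact hy l hpos (by omega) hlw

lemma mul_geodesicCount_le (hS : ∀ x y, R x y → x ∈ S ∧ y ∈ S)
    (hR : ∀ k x, 1 ≤ k → k ≤ m → ¬ IsWalk R k x x) {i : ℕ}
    (hi : 1 ≤ i) (him : i + 2 ≤ m)
    (hmin : ∀ j, 1 ≤ j → j + 2 ≤ m → geodesicCount R i ≤ geodesicCount R j)
    (hmin' : ∀ j, 1 ≤ j → j + 2 ≤ m → geodesicCount R i ≤ geodesicCount (flip R) j) :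
    (m - 2) * geodesicCount R i ≤
      ∑ v ∈ S, arcs (NonAdj R) (outBall R i v) (S \ outBall R i v) := by
  let P : ℕ → V × V × V → Prop := fun n t =>
    if n + 1 ≤ m - i then
      AtDist R (n + 1) t.2.2 t.1 ∧ R t.1 t.2.1 ∧ AtDist R (n + 2) t.2.2 t.2.1
    else R t.2.2 t.1 ∧ AtDist R (m - n) t.1 t.2.1 ∧ AtDist R (m - n + 1) t.2.2 t.2.1
  have hP1 : ∀ n t, n + 1 ≤ m - i → P n t →
      AtDist R (n + 1) t.2.2 t.1 ∧ R t.1 t.2.1 ∧ AtDist R (n + 2) t.2.2 t.2.1 :=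
    fun n t hn h => by simpa only [P, if_pos hn] using h
  have hP2 : ∀ n t, ¬ n + 1 ≤ m - i → P n t →
      R t.2.2 t.1 ∧ AtDist R (m - n) t.1 t.2.1 ∧ AtDist R (m - n + 1) t.2.2 t.2.1 :=
    fun n t hn h => by simpa only [P, if_neg hn] using h
  have hcard : ∀ n ∈ range (m - 2), geodesicCount R i ≤ #{t | P n t} := by
    intro n hn
    rw [mem_range] at hn
    by_cases hni : n + 1 ≤ m - i
    · refine (hmin (n + 1) (by omega) (by omega)).trans ?_
      refine card_le_card_of_injOn (fun t => (t.2.1, t.2.2, t.1)) ?_ ?_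
      · rintro ⟨b, p, q⟩ h
        simp only [coe_filter, mem_univ, true_and, Set.mem_ofPred_eq] at h
        simp only [P, if_pos hni, coe_filter, mem_univ, true_and, Set.mem_ofPred_eq]
        exact h
      · rintro ⟨b, p, q⟩ _ ⟨b', p', q'⟩ _ h
        simp only [Prod.mk.injEq] at h ⊢
        tauto
    · refine (hmin' (m - n) (by omega) (by omega)).trans ?_
      refine card_le_card_of_injOn (fun t => (t.2.1, t.1, t.2.2)) ?_ ?_
      · rintro ⟨b, p, q⟩ h
        simp only [coe_filter, mem_univ, true_and, Set.mem_ofPred_eq, atDist_flip] at h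
        simp only [P, if_neg hni, coe_filter, mem_univ, true_and, Set.mem_ofPred_eq]
        exact ⟨h.2.1, h.1, h.2.2⟩
      · rintro ⟨b, p, q⟩ _ ⟨b', p', q'⟩ _ h
        simp only [Prod.mk.injEq] at h ⊢
        tauto
  have hdisj : Set.PairwiseDisjoint (↑(range (m - 2)))
      (fun n => ({t | P n t} : Finset (V × V × V))) := by
    intro n hn n' hn' hne
    simp only [coe_range, Set.mem_Iio] at hn hn'
    rw [Function.onFun, disjoint_filter]
    intro t _ h h'
    by_cases hni : n + 1 ≤ m - i <;> by_cases hni' : n' + 1 ≤ m - i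
    · have := (hP1 _ _ hni h).1.unique (hP1 _ _ hni' h').1
      omega
    · exact (hP2 _ _ hni' h').2.1.2 1 (by omega) (isWalk_one.2 (hP1 _ _ hni h).2.1)
    · exact (hP2 _ _ hni h).2.1.2 1 (by omega) (isWalk_one.2 (hP1 _ _ hni' h').2.1)
    · have := (hP2 _ _ hni h).2.1.unique (hP2 _ _ hni' h').2.1
      omega
  calc (m - 2) * geodesicCount R i = #(range (m - 2)) • geodesicCount R i := by simp
    _ ≤ ∑ n ∈ range (m - 2), #{t | P n t} := card_nsmul_le_sum _ _ _ hcard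
    _ = #((range (m - 2)).biUnion fun n => {t | P n t}) := (card_biUnion hdisj).symm
    _ ≤ _ := by
      rw [sum_arcs]
      refine card_le_card ?_
      rintro ⟨v, x, y⟩ h
      simp only [mem_biUnion, mem_range, mem_filter, mem_univ, true_and] at h
      obtain ⟨n, hn, h⟩ := h
      simp only [outBall, mem_filter, mem_univ, true_and, mem_sdiff, not_exists, not_and]
      by_cases hni : n + 1 ≤ m - i
      · obtain ⟨h1, h2, h3⟩ := hP1 _ _ hni h
        dsimp only at h1 h2 h3
        have hy : y ∈ S := by
          obtain ⟨f, h0, -, hf⟩ := h1.1.exists_seq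
          exact h0 ▸ (hS _ _ (hf 0 (by omega))).1
        refine ⟨(hS _ _ h2).1, ⟨1, le_rfl, hi, isWalk_one.2 h2⟩, ⟨hy, fun k hk hki hw => ?_⟩,
          nonAdj_of_atDist hR (by omega) (by omega) h3⟩
        exact hR _ v (by omega) (by omega) (hw.append h1.1)
      · obtain ⟨h1, h2, h3⟩ := hP2 _ _ hni h
        dsimp only at h1 h2 h3
        refine ⟨(hS _ _ h1).2, ⟨m - n, by omega, by omega, h2.1⟩,
          ⟨(hS _ _ h1).1, fun k hk hki hw => ?_⟩,
          nonAdj_of_atDist hR (by omega) (by omega) h3⟩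
        exact hR _ v (by omega) (by omega) (hw.append (isWalk_one.2 h1))

lemma exists_cut_of_geodesicCount_le (hS : ∀ x y, R x y → x ∈ S ∧ y ∈ S) (hne : S.Nonempty)
    (hout : ∀ x ∈ S, ∃ y, R x y)
    (hR : ∀ k x, 1 ≤ k → k ≤ m → ¬ IsWalk R k x x) {i : ℕ}
    (hi : 1 ≤ i) (him : i + 2 ≤ m)
    (hmin : ∀ j, 1 ≤ j → j + 2 ≤ m → geodesicCount R i ≤ geodesicCount R j)
    (hmin' : ∀ j, 1 ≤ j → j + 2 ≤ m → geodesicCount R i ≤ geodesicCount (flip R) j) :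
    ∃ A ⊆ S, A.Nonempty ∧ (S \ A).Nonempty ∧
      (m - 2) * arcs R A (S \ A) ≤ arcs (NonAdj R) A (S \ A) := by
  have hsum : ∑ v ∈ S, (m - 2) * arcs R (outBall R i v) (S \ outBall R i v) ≤
      ∑ v ∈ S, arcs (NonAdj R) (outBall R i v) (S \ outBall R i v) := by
    rw [← mul_sum]
    exact (Nat.mul_le_mul_left _ (sum_arcs_outBall_le hR hi him)).trans
      (mul_geodesicCount_le hS hR hi him hmin hmin')
  obtain ⟨v, hv, hle⟩ := exists_le_of_sum_le hne hsum
  obtain ⟨w, hw⟩ := hout v hv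
  refine ⟨outBall R i v, fun x hx => ?_, ⟨w, ?_⟩, ⟨v, ?_⟩, hle⟩
  · simp only [outBall, mem_filter, mem_univ, true_and] at hx
    obtain ⟨k, hk, -, hx⟩ := hx
    obtain ⟨l, rfl⟩ := Nat.exists_eq_add_of_le' hk
    obtain ⟨u, -, hu⟩ := hx
    exact (hS _ _ hu).2
  · simp only [outBall, mem_filter, mem_univ, true_and]
    exact ⟨1, le_rfl, hi, isWalk_one.2 hw⟩
  · simp only [outBall, mem_filter, mem_univ, true_and, mem_sdiff, not_exists, not_and]
    exact ⟨hv, fun k hk hki => hR k v hk (by omega)⟩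

lemma exists_cut (hm : 3 ≤ m) (hS : ∀ x y, R x y → x ∈ S ∧ y ∈ S) (hnt : S.Nontrivial)
    (hR : ∀ k x, 1 ≤ k → k ≤ m → ¬ IsWalk R k x x) :
    ∃ A ⊆ S, A.Nonempty ∧ (S \ A).Nonempty ∧
      (m - 2) * arcs R A (S \ A) ≤ arcs (NonAdj R) A (S \ A) := by
  by_cases hout : ∀ x ∈ S, ∃ y, R x y
  swap
  · push Not at hout
    obtain ⟨x, hx, hxy⟩ := hout
    refine ⟨{x}, by simpa using hx, by simp, ?_, by simp [arcs, hxy]⟩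
    obtain ⟨y, hy, hyx⟩ := hnt.exists_ne x
    exact ⟨y, by simp [hy, hyx]⟩
  by_cases hin : ∀ x ∈ S, ∃ y, flip R x y
  swap
  · push Not at hin
    obtain ⟨x, hx, hxy⟩ := hin
    refine ⟨S \ {x}, sdiff_subset, ?_, ?_, ?_⟩
    · obtain ⟨y, hy, hyx⟩ := hnt.exists_ne x
      exact ⟨y, by simp [hy, hyx]⟩
    · rw [Finset.sdiff_sdiff_eq_self (by simpa using hx)]
      simp
    · rw [Finset.sdiff_sdiff_eq_self (by simpa using hx), ← arcs_flip (R := R)]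
      simp [arcs, hxy]
  have hI : (Icc 1 (m - 2)).Nonempty := ⟨1, by simp; omega⟩
  obtain ⟨i, hi, himin⟩ := exists_min_image _ (geodesicCount R) hI
  obtain ⟨j, hj, hjmin⟩ := exists_min_image _ (geodesicCount (flip R)) hI
  simp only [mem_Icc] at hi hj himin hjmin
  rcases le_total (geodesicCount R i) (geodesicCount (flip R) j) with hij | hij
  · exact exists_cut_of_geodesicCount_le hS hnt.nonempty hout hR hi.1 (by omega)
      (fun k hk hkm => himin k ⟨hk, by omega⟩)
      (fun k hk hkm => hij.trans (hjmin k ⟨hk, by omega⟩))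
  · obtain ⟨A, hA, hA1, hA2, hle⟩ :=
      exists_cut_of_geodesicCount_le (R := flip R) (m := m) (fun x y h => (hS y x h).symm)
        hnt.nonempty hin
        (fun k x hk hkm h => hR k x hk hkm (isWalk_flip.1 h)) hj.1 (by omega)
        (fun k hk hkm => hjmin k ⟨hk, by omega⟩)
        (fun k hk hkm => hij.trans (himin k ⟨hk, by omega⟩))
    refine ⟨S \ A, sdiff_subset, hA2, ?_, ?_⟩
    · rwa [Finset.sdiff_sdiff_eq_self hA]
    · rw [Finset.sdiff_sdiff_eq_self hA]
      rwa [nonAdj_flip, arcs_flip, arcs_flip] at hle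

end Cuts

section Feedback

variable {V : Type*} {R : V → V → Prop} {m : ℕ}

/-- Arcs `x → y` with `r x ≤ r y` form a feedback arc set; an `m`-free digraph has one of size at
most `1 / (m - 2)` times the number of nonadjacent pairs. -/
lemma exists_rank [Fintype V] (hm : 3 ≤ m) (hfree : MFree R m) (S : Finset V) :
    ∃ r : V → ℕ, 2 * ((m - 2) * arcs (fun x y => R x y ∧ r x ≤ r y) S S) ≤
      arcs (NonAdj R) S S := by
  induction S using Finset.strongInduction with
  | H S ih =>
    have hloop : ∀ x, ¬ R x x := fun x hx =>
      hfree.not_isWalk 1 x le_rfl (by omega) (isWalk_one.2 hx)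
    rcases S.eq_empty_or_nonempty with rfl | hne
    · exact ⟨fun _ => 0, by simp [arcs]⟩
    rcases hne.exists_eq_singleton_or_nontrivial with ⟨x, rfl⟩ | hnt
    · exact ⟨fun _ => 0, by simp [arcs, filter_singleton, hloop]⟩
    obtain ⟨A, hAS, hA1, hA2, hle⟩ := exists_cut (R := fun x y => x ∈ S ∧ y ∈ S ∧ R x y) hm
      (fun x y h => ⟨h.1, h.2.1⟩) hnt (hfree.mono fun x y h => h.2.2).not_isWalk
    rw [arcs_congr (R := fun x y => x ∈ S ∧ y ∈ S ∧ R x y) (R' := R)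
        fun x hx y hy => by simp [hAS hx, (mem_sdiff.1 hy).1],
      arcs_congr (R := NonAdj _) (R' := NonAdj R)
        fun x hx y hy => by simp [NonAdj, hAS hx, (mem_sdiff.1 hy).1]] at hle
    obtain ⟨r, hr⟩ := ih A (hAS.ssubset_of_not_subset (sdiff_nonempty.1 hA2))
    obtain ⟨s, hs⟩ := ih (S \ A) (sdiff_ssubset hAS hA1)
    let t : V → ℕ := fun x => if x ∈ A then r x else s x + A.sup r + 1
    have htA : ∀ x ∈ A, t x = r x := fun x hx => if_pos hx
    have htB : ∀ x ∈ S \ A, t x = s x + A.sup r + 1 := fun x hx => if_neg (mem_sdiff.1 hx).2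
    have h1 : arcs (fun x y => R x y ∧ t x ≤ t y) A A =
        arcs (fun x y => R x y ∧ r x ≤ r y) A A :=
      arcs_congr fun x hx y hy => by rw [htA x hx, htA y hy]
    have h2 : arcs (fun x y => R x y ∧ t x ≤ t y) (S \ A) (S \ A) =
        arcs (fun x y => R x y ∧ s x ≤ s y) (S \ A) (S \ A) :=
      arcs_congr fun x hx y hy => by rw [htB x hx, htB y hy]; simp
    have h3 : arcs (fun x y => R x y ∧ t x ≤ t y) A (S \ A) ≤ arcs R A (S \ A) :=
      arcs_mono fun x _ y _ h => h.1
    have h4 : arcs (fun x y => R x y ∧ t x ≤ t y) (S \ A) A = 0 := by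
      refine sum_eq_zero fun x hx => card_eq_zero.2 (eq_empty_of_forall_notMem fun y hy => ?_)
      simp only [mem_filter] at hy
      obtain ⟨hy, -, this⟩ := hy
      rw [htB x hx, htA y hy] at this
      have := le_sup (f := r) hy
      omega
    have h5 : arcs (NonAdj R) (S \ A) A = arcs (NonAdj R) A (S \ A) := by
      rw [← arcs_flip, ← nonAdj_flip]
      exact arcs_congr fun x _ y _ => by simp only [NonAdj, flip]; tauto
    refine ⟨t, ?_⟩
    rw [arcs_split hAS, arcs_split (R := NonAdj R) hAS, h1, h2, h4, h5]
    have := Nat.mul_le_mul_left (m - 2) h3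
    nlinarith

lemma mul_succ_le_arcs (r : V → ℕ) (δ : ℕ) (S : Finset V) (hne : S.Nonempty)
    (hdeg : ∀ x ∈ S, δ ≤ #{y ∈ S | R x y}) (hloop : ∀ x, ¬ R x x) :
    δ * (δ + 1) ≤ 2 * arcs (fun x y => R x y ∧ r x ≤ r y) S S := by
  induction δ generalizing S with
  | zero => simp
  | succ δ ih =>
    obtain ⟨x, hx, hmin⟩ := exists_min_image S r hne
    have hsplit := arcs_split (R := fun x y => R x y ∧ r x ≤ r y) (singleton_subset_iff.2 hx)
    have hx1 : #{y ∈ S | R x y} ≤ arcs (fun x y => R x y ∧ r x ≤ r y) {x} (S \ {x}) := by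
      simp only [arcs, sum_singleton]
      refine card_le_card fun y hy => ?_
      rw [mem_filter] at hy
      have : y ≠ x := by rintro rfl; exact hloop _ hy.2
      simp [hy.1, this, hy.2, hmin y hy.1]
    have hd := hdeg x hx
    have hne' : (S \ {x}).Nonempty := by
      obtain ⟨y, hy⟩ := card_pos.1 ((Nat.succ_pos δ).trans_le hd)
      rw [mem_filter] at hy
      have : y ≠ x := by rintro rfl; exact hloop _ hy.2
      exact ⟨y, by simp [hy.1, this]⟩
    have := ih (S \ {x}) hne' fun z hz => by
      have h1 := hdeg z (mem_sdiff.1 hz).1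
      have h2 : #{y ∈ S | R z y} ≤ #{y ∈ S \ {x} | R z y} + 1 := by
        rw [← card_singleton x]
        refine (card_le_card fun y hy => ?_).trans (card_union_le _ _)
        rw [mem_filter] at hy
        by_cases hyx : y = x <;> simp [hyx, hy.1, hy.2]
      omega
    nlinarith

end Feedback

section MinimalCounterexample

variable {V : Type*} {Adj : V → V → Prop} {m : ℕ} {lam : ℝ}

/-- The second out-neighborhood of `v` in the subdigraph induced on `S`. -/
noncomputable def secondOut (Adj : V → V → Prop) (S : Finset V) (v : V) : Finset V :=
  {w ∈ S | w ≠ v ∧ ¬ Adj v w ∧ ∃ u ∈ S, Adj v u ∧ Adj u w}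

lemma root_gt (hm : 3 ≤ m) (hlam : lam ∈ Set.Ioo (0 : ℝ) 1) (hroot : gpoly m lam = 0) :
    63 / 100 < lam := by
  by_contra! h
  have hm' : (3 : ℝ) ≤ m := by exact_mod_cast hm
  have h2 : lam ^ 2 ≤ (63 / 100) ^ 2 := pow_le_pow_left₀ hlam.1.le h 2
  have h3 : lam ^ 3 ≤ (63 / 100) ^ 3 := pow_le_pow_left₀ hlam.1.le h 3
  have h4 : 0 ≤ ((m : ℝ) - 2) * (1 - lam) ^ 2 := mul_nonneg (by linarith) (sq_nonneg _)
  unfold gpoly at hroot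
  linarith

lemma counting_bounds_false (hm : 3 ≤ m) (hlam : lam ∈ Set.Ioo (0 : ℝ) 1)
    (hroot : gpoly m lam = 0) {a b k x : ℝ} (ha : 0 < a) (hb : b < lam * a) (hkb : k ≤ b)
    (hk : a ≤ x + k) (hx : (1 + lam) * x ≤ a) (hab : a ^ 2 ≤ 2 * (a * b))
    (hmain : a ^ 2 + ((m : ℝ) - 2) * (a - b) ^ 2 + 2 * (k * (a - lam * k)) - k ^ 2 ≤
      2 * (a * b)) : False := by
  have hgt := root_gt hm hlam hroot
  have hm' : (3 : ℝ) ≤ m := by exact_mod_cast hm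
  obtain ⟨h0, h1⟩ := hlam
  have hb2 : a / 2 ≤ b := by nlinarith
  have hk2 : lam * a ≤ (1 + lam) * k := by nlinarith
  have hsum : a ≤ (lam + 1 / 2) * (k + b) := by
    have hpoly : 0 ≤ 6 * lam ^ 2 + lam - 3 := by nlinarith
    have h3 : (1 + lam) * (a / 2) ≤ (1 + lam) * b := mul_le_mul_of_nonneg_left hb2 (by linarith)
    have h4 : (lam + 1 / 2) * (lam * a + (1 + lam) * (a / 2)) ≤
        (lam + 1 / 2) * ((1 + lam) * k + (1 + lam) * b) :=
      mul_le_mul_of_nonneg_left (by linarith) (by linarith)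
    have h5 := mul_nonneg ha.le hpoly
    refine le_of_mul_le_mul_left (a := 1 + lam) ?_ (by linarith)
    nlinarith
  have hconc : 0 ≤ (b - k) * ((lam + 1 / 2) * (k + b) - a) :=
    mul_nonneg (by linarith) (by linarith)
  have hend : a ^ 2 + ((m : ℝ) - 2) * (a - b) ^ 2 - (2 * lam + 1) * b ^ 2 ≤ 0 := by nlinarith
  have hsq1 : ((1 - lam) * a) ^ 2 ≤ (a - b) ^ 2 :=
    pow_le_pow_left₀ (mul_nonneg (by linarith) ha.le) (by nlinarith) 2
  have hsq2 : b ^ 2 < (lam * a) ^ 2 := pow_lt_pow_left₀ hb (by linarith) (by norm_num)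
  have h6 := mul_le_mul_of_nonneg_left hsq1 (show (0 : ℝ) ≤ (m : ℝ) - 2 by linarith)
  have h7 := mul_lt_mul_of_pos_left hsq2 (show (0 : ℝ) < 2 * lam + 1 by linarith)
  have h8 : a ^ 2 * gpoly m lam = 0 := by rw [hroot, mul_zero]
  unfold gpoly at h8
  nlinarith

lemma exists_large_secondOut [Fintype V] (hm : 3 ≤ m)
    (hdig : ∀ a b : V, ¬ (Adj a b ∧ Adj b a)) (hloop : ∀ v : V, ¬ Adj v v)
    (hfree : MFree Adj m) (hlam : lam ∈ Set.Ioo (0 : ℝ) 1) (hroot : gpoly m lam = 0)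
    (S : Finset V) (hne : S.Nonempty) :
    ∃ v ∈ S, lam * (#{w ∈ S | Adj v w} : ℝ) ≤ #(secondOut Adj S v) := by
  induction S using Finset.strongInduction with
  | H S ih =>
    by_contra! hcon
    obtain ⟨u, hu, hmin⟩ := exists_min_image S (fun v => #{w ∈ S | Adj v w}) hne
    set A : Finset V := {w ∈ S | Adj u w} with hA
    set B : Finset V := secondOut Adj S u with hB
    have hAS : A ⊆ S := filter_subset _ _
    have hBS : B ⊆ S := filter_subset _ _
    have hbA : (#B : ℝ) < lam * #A := hcon u hu
    have hAne : A.Nonempty := by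
      rw [nonempty_iff_ne_empty]
      intro h
      rw [h] at hbA
      simp only [card_empty, Nat.cast_zero, mul_zero] at hbA
      exact absurd hbA (not_lt.2 (Nat.cast_nonneg _))
    have hpos : (0 : ℝ) < #A := by exact_mod_cast hAne.card_pos
    have hAB : Disjoint A B := disjoint_left.2 fun w hwA hwB =>
      (mem_filter.1 hwB).2.2.1 (mem_filter.1 hwA).2
    have hnbr : ∀ x ∈ A, ∀ w ∈ S, Adj x w → w ∈ A ∪ B := by
      intro x hx w hw hxw
      rw [hA, mem_filter] at hx
      by_cases huw : Adj u w
      · exact mem_union_left _ (mem_filter.2 ⟨hw, huw⟩)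
      · refine mem_union_right _ (mem_filter.2 ⟨hw, ?_, huw, x, hx.1, hx.2, hxw⟩)
        rintro rfl
        exact hdig _ _ ⟨hx.2, hxw⟩
    have hdegA : ∀ x ∈ A, #{w ∈ S | Adj x w} = #{w ∈ A | Adj x w} + #{w ∈ B | Adj x w} := by
      intro x hx
      rw [← card_union_of_disjoint (disjoint_filter_filter hAB), ← filter_union]
      congr 1
      ext w
      simp only [mem_filter]
      exact ⟨fun h => ⟨hnbr x hx w h.1 h.2, h.2⟩, fun h => ⟨union_subset hAS hBS h.1, h.2⟩⟩
    have hssub : A ⊂ S := hAS.ssubset_of_mem_notMem hu fun h => hloop u (mem_filter.1 h).2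
    obtain ⟨x, hxA, hx⟩ := ih A hssub hAne
    set X : Finset V := {w ∈ A | Adj x w}
    set Y : Finset V := {w ∈ B | Adj x w}
    set Q : Finset V := secondOut Adj A x
    have hYB : Y ⊆ B := filter_subset _ _
    have hxS := hAS hxA
    have hXQ : #X + #Q ≤ #A := by
      rw [← card_union_of_disjoint]
      · exact card_le_card (union_subset (filter_subset _ _) (filter_subset _ _))
      · exact disjoint_left.2 fun w hwX hwQ => (mem_filter.1 hwQ).2.2.1 (mem_filter.1 hwX).2
    have hdx : #{w ∈ S | Adj x w} = #X + #Y := hdegA x hxA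
    have hYdeg : ∀ y ∈ Y, (#A : ℝ) - lam * #Y ≤ #{w ∈ A ∪ Y | Adj y w} := by
      intro y hy
      have hyB := hYB hy
      have hyS := hBS hyB
      have hxy : Adj x y := (mem_filter.1 hy).2
      have hsplit : #{w ∈ S | Adj y w} ≤
          #{w ∈ A ∪ Y | Adj y w} + #{w ∈ S \ (A ∪ Y) | Adj y w} := by
        refine (card_le_card fun w hw => ?_).trans (card_union_le _ _)
        rw [mem_filter] at hw
        by_cases hwAY : w ∈ A ∪ Y
        · exact mem_union_left _ (mem_filter.2 ⟨hwAY, hw.2⟩)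
        · exact mem_union_right _ (mem_filter.2 ⟨mem_sdiff.2 ⟨hw.1, hwAY⟩, hw.2⟩)
      have hQ : #{w ∈ S \ (A ∪ Y) | Adj y w} + #Q ≤ #(secondOut Adj S x) := by
        rw [← card_union_of_disjoint]
        · refine card_le_card (union_subset (fun w hw => ?_) fun w hw => ?_)
          · simp only [mem_filter, mem_sdiff, mem_union, not_or] at hw
            refine mem_filter.2 ⟨hw.1.1, ?_, fun hxw => ?_, y, hyS, hxy, hw.2⟩
            · rintro rfl
              exact hw.1.2.1 hxA
            · rcases mem_union.1 (hnbr x hxA w hw.1.1 hxw) with h | h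
              · exact hw.1.2.1 h
              · exact hw.1.2.2 (mem_filter.2 ⟨h, hxw⟩)
          · obtain ⟨hwA, hwx, hxw, z, hz, hxz, hzw⟩ := mem_filter.1 hw
            exact mem_filter.2 ⟨hAS hwA, hwx, hxw, z, hAS hz, hxz, hzw⟩
        · refine disjoint_left.2 fun w hw hwQ => ?_
          exact (mem_sdiff.1 (mem_filter.1 hw).1).2 (mem_union_left _ (mem_filter.1 hwQ).1)
      have hlt := hcon x hxS
      rw [hdx] at hlt
      have h1 : #A ≤ #{w ∈ S | Adj y w} := hmin y hyS
      have h2 : (#A : ℝ) ≤ #{w ∈ A ∪ Y | Adj y w} + #{w ∈ S \ (A ∪ Y) | Adj y w} := by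
        exact_mod_cast h1.trans hsplit
      have h3 : (#{w ∈ S \ (A ∪ Y) | Adj y w} : ℝ) + #Q ≤ #(secondOut Adj S x) := by
        exact_mod_cast hQ
      push_cast at hlt
      linarith
    have hAAB : (#A : ℝ) * #A ≤ arcs Adj A (A ∪ B) := card_mul_le_arcs fun z hz => by
      rw [filter_union, card_union_of_disjoint (disjoint_filter_filter hAB), ← hdegA z hz]
      exact_mod_cast hmin z (hAS hz)
    have hYAY : (#Y : ℝ) * (#A - lam * #Y) ≤ arcs Adj Y (A ∪ Y) := card_mul_le_arcs hYdeg
    rw [arcs_union_right hAB] at hAAB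
    rw [arcs_union_right (hAB.mono_right hYB)] at hYAY
    have hABle : arcs Adj A B + arcs Adj Y A ≤ #A * #B := by
      have h1 : arcs Adj Y A ≤ arcs Adj B A := sum_le_sum_of_subset hYB
      have h2 : arcs Adj A B + arcs (flip Adj) A B ≤ #A * #B :=
        arcs_add_le fun z _ w _ hzw hwz => hdig z w ⟨hzw, hwz⟩
      rw [arcs_flip] at h2
      omega
    have hAA := two_mul_arcs_add_le (A := A) hdig
    have hYY := two_mul_arcs_add_le (A := Y) hdig
    obtain ⟨r, hr⟩ := exists_rank hm hfree A
    have hδ := mul_succ_le_arcs (R := Adj) r (#A - #B) A hAne (fun z hz => by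
      have h1 : #A ≤ #{w ∈ S | Adj z w} := hmin z (hAS hz)
      have h2 : #{w ∈ B | Adj z w} ≤ #B := card_le_card (filter_subset _ _)
      have h3 := hdegA z hz
      omega) hloop
    have hba : #B ≤ #A := by
      have h1 : (#B : ℝ) ≤ #A := by nlinarith [hlam.2]
      exact_mod_cast h1
    have hΓ : ((m : ℝ) - 2) * (#A - #B : ℝ) ^ 2 ≤ arcs (NonAdj Adj) A A := by
      have h1 : (m - 2) * (#A - #B) ^ 2 ≤ arcs (NonAdj Adj) A A := by
        refine le_trans ?_ hr
        rw [mul_left_comm]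
        exact Nat.mul_le_mul_left _ (le_trans (by nlinarith) hδ)
      have h2 : (((m - 2) * (#A - #B) ^ 2 : ℕ) : ℝ) ≤ arcs (NonAdj Adj) A A := by
        exact_mod_cast h1
      rwa [Nat.cast_mul, Nat.cast_pow, Nat.cast_sub hba, Nat.cast_sub (by omega)] at h2
    have hAA' : 2 * (arcs Adj A A : ℝ) + arcs (NonAdj Adj) A A ≤ #A * #A := by exact_mod_cast hAA
    have hYY' : 2 * (arcs Adj Y Y : ℝ) ≤ #Y * #Y := by
      exact_mod_cast (Nat.le_add_right _ _).trans hYY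
    have hABle' : (arcs Adj A B : ℝ) + arcs Adj Y A ≤ #A * #B := by exact_mod_cast hABle
    have hXQ' : (#X : ℝ) + #Q ≤ #A := by exact_mod_cast hXQ
    have hxmin : (#A : ℝ) ≤ #X + #Y := by exact_mod_cast (hmin x hxS).trans hdx.le
    push_cast at hAAB hYAY
    have hnn1 : (0 : ℝ) ≤ arcs (NonAdj Adj) A A := Nat.cast_nonneg _
    have hnn2 : (0 : ℝ) ≤ arcs Adj Y A := Nat.cast_nonneg _
    exact counting_bounds_false hm hlam hroot hpos hbA (by exact_mod_cast card_le_card hYB) hxmin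
      (by linarith) (by linarith) (by linarith)

end MinimalCounterexample

end SecondNeighborhood

theorem second_neighborhood_m_free {V : Type*} [Fintype V] [Nonempty V]
    (m : ℕ) (hm : 3 ≤ m)
    (Adj : V → V → Prop)
    (hdigonless : ∀ a b : V, ¬ (Adj a b ∧ Adj b a))
    (hloopless : ∀ v : V, ¬ Adj v v)
    (hfree : MFree Adj m)
    (lam : ℝ) (hlam : lam ∈ Set.Ioo (0 : ℝ) 1) (hroot : gpoly m lam = 0) :
    ∃ v : V, lam * (outDeg Adj v : ℝ) ≤ ((secondNbr Adj v).ncard : ℝ) := by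
  classical
  obtain ⟨v, -, hv⟩ := exists_large_secondOut hm hdigonless hloopless hfree hlam hroot
    Finset.univ Finset.univ_nonempty
  refine ⟨v, ?_⟩
  convert hv using 3
  · rw [outDeg, ← Set.ncard_coe_finset]
    simp
  · rw [← Set.ncard_coe_finset]
    simp [secondNbr, secondOut]
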